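/- arXiv:2605.09432 — 2 statements merged into one kernel-verified Lean document; each statement's English description precedes it below -/
import Mathlib

section
/- For every nonempty demand set E on a finite node set V with |V| = n ≥ 2, there exists a 2-hop solution for E of length at most 2(n−1). -/
/-- A demand `(i,j)` is served by schedule `L` along a path of length `ℓ ≥ 1`:
there are flights at increasing positions of `L` forming a path `i = w₀, w₁, …, w_ℓ = j`.
This is encoded by a node list `w` of length `ℓ + 1` whose list of consecutive pairs
is a sublist (ordered subsequence) of `L`. -/
def ServesPath {V : Type*} (L : List (V × V)) (i j : V) (ℓ : ℕ) : Prop :=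
  1 ≤ ℓ ∧ ∃ w : List V, w.length = ℓ + 1 ∧ w.head? = some i ∧ w.getLast? = some j ∧
    (w.zip w.tail).Sublist L

/-- `L` is a multihop solution for the demand set `E`: every demand is served
along a path of some length `ℓ ≥ 1`. -/
def IsMultihopSolution {V : Type*} (L : List (V × V)) (E : Finset (V × V)) : Prop :=
  ∀ p ∈ E, ∃ ℓ, ServesPath L p.1 p.2 ℓ

/-- `L` is a 2-hop solution for the demand set `E`: every demand is served
along a path of length at most 2. -/
def IsTwoHopSolution {V : Type*} (L : List (V × V)) (E : Finset (V × V)) : Prop :=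
  ∀ p ∈ E, ∃ ℓ ≤ 2, ServesPath L p.1 p.2 ℓ

/-- Node `v` is incident to some demand of `E`. -/
def Touches {V : Type*} (E : Finset (V × V)) (v : V) : Prop :=
  ∃ p ∈ E, p.1 = v ∨ p.2 = v

/-- `E` is weakly connected: in the undirected graph on the nodes incident to some
demand, with an edge `{u,v}` whenever `(u,v) ∈ E` or `(v,u) ∈ E`, every two incident
nodes are joined by a path. -/
def WeaklyConnected {V : Type*} (E : Finset (V × V)) : Prop :=
  ∀ u v : V, Touches E u → Touches E v →
    Relation.ReflTransGen (fun a b => (a, b) ∈ E ∨ (b, a) ∈ E) u v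

/-- A single flight of the schedule serves its demand. -/
theorem servesPath_one_of_mem {V : Type*} {L : List (V × V)} {i j : V} (h : (i, j) ∈ L) :
    ServesPath L i j 1 :=
  ⟨le_rfl, [i, j], rfl, rfl, rfl, by simpa using h⟩

/-- A flight of the first block followed by a flight of the second block serves a demand. -/
theorem servesPath_two_of_mem_append {V : Type*} {L₁ L₂ : List (V × V)} {i c j : V}
    (h₁ : (i, c) ∈ L₁) (h₂ : (c, j) ∈ L₂) : ServesPath (L₁ ++ L₂) i j 2 :=
  ⟨one_le_two, [i, c, j], rfl, rfl, rfl,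
    (List.singleton_sublist.2 h₁).append (List.singleton_sublist.2 h₂)⟩

/-- Every nonempty demand set on a finite node set of `n ≥ 2` nodes admits a 2-hop
solution of length at most `2(n − 1)`. -/
theorem twohop_length_bound {V : Type*} [Fintype V] [DecidableEq V]
    (n : ℕ) (hn : 2 ≤ n) (hcard : Fintype.card V = n)
    (E : Finset (V × V)) (hE : ∀ p ∈ E, p.1 ≠ p.2) (hne : E.Nonempty) :
    ∃ L : List (V × V), IsTwoHopSolution L E ∧ L.length ≤ 2 * (n - 1) := by
  obtain ⟨⟨c, -⟩, -⟩ := hne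
  let S := (Finset.univ.erase c).toList
  have mem_S : ∀ {v}, v ≠ c → v ∈ S := fun hv => by simp [S, hv]
  refine ⟨S.map (fun v => (v, c)) ++ S.map (fun v => (c, v)), ?_, ?_⟩
  · rintro ⟨i, j⟩ hp
    have hij : i ≠ j := hE _ hp
    by_cases hi : i = c
    · subst hi
      exact ⟨1, one_le_two, servesPath_one_of_mem
        (List.mem_append_right _ (List.mem_map_of_mem (mem_S hij.symm)))⟩
    · by_cases hj : j = c
      · subst hj
        exact ⟨1, one_le_two, servesPath_one_of_mem
          (List.mem_append_left _ (List.mem_map.2 ⟨i, mem_S hi, rfl⟩))⟩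
      · exact ⟨2, le_rfl, servesPath_two_of_mem_append (c := c)
          (List.mem_map.2 ⟨i, mem_S hi, rfl⟩) (List.mem_map.2 ⟨j, mem_S hj, rfl⟩)⟩
  · simp [S, hcard, two_mul]
end

section
/- Let E = E_1 ∪ E_2 be a demand set such that no node of V is incident to a demand of E_1 and also to a demand of E_2. Then the minimum length of a multihop solution for E equals the minimum length of a multihop solution for E_1 plus the minimum length of a multihop solution for E_2. -/
/-- The pair `(x, y)` is served by `L` along a path of some length. -/
def Reaches {V : Type*} (L : List (V × V)) (x y : V) : Prop :=
  ∃ ℓ, ServesPath L x y ℓ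

theorem Reaches.mono {V : Type*} {L L' : List (V × V)} {x y : V} (h : Reaches L x y)
    (hL : L.Sublist L') : Reaches L' x y := by
  obtain ⟨ℓ, hℓ, w, h1, h2, h3, h4⟩ := h
  exact ⟨ℓ, hℓ, w, h1, h2, h3, h4.trans hL⟩

theorem List.zip_tail_append_pair {V : Type*} (l : List V) (z y : V) :
    (l ++ [z, y]).zip (l ++ [z, y]).tail =
      (l ++ [z]).zip (l ++ [z]).tail ++ [(z, y)] := by
  induction l with
  | nil => simp
  | cons a l ih => cases l <;> simp_all

theorem List.zip_tail_sublist_append_right {V : Type*} (s t : List V) :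
    (s.zip s.tail).Sublist ((s ++ t).zip (s ++ t).tail) := by
  induction s with
  | nil => simp
  | cons a s ih => cases s <;> simp_all

theorem List.zip_tail_sublist_append_left {V : Type*} (s t : List V) :
    (t.zip t.tail).Sublist ((s ++ t).zip (s ++ t).tail) := by
  induction s with
  | nil => simp
  | cons a s ih =>
    refine ih.trans ?_
    simp only [List.cons_append, List.tail_cons]
    cases s ++ t <;> simp

/-- The last flight of a schedule can only be the last hop of a served path. -/
theorem Reaches.of_concat {V : Type*} {L : List (V × V)} {u v x y : V}
    (h : Reaches (L ++ [(u, v)]) x y) :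
    Reaches L x y ∨ (y = v ∧ (x = u ∨ Reaches L x u)) := by
  obtain ⟨ℓ, hℓ, w, h1, h2, h3, h4⟩ := h
  obtain ⟨l₁, l₂, hw, hl₁, hl₂⟩ := List.sublist_append_iff.1 h4
  rcases List.sublist_singleton.1 hl₂ with rfl | rfl
  · left
    exact ⟨ℓ, hℓ, w, h1, h2, h3, by simpa [hw] using hl₁⟩
  · right
    rcases List.eq_nil_or_concat w with rfl | ⟨w', b, rfl⟩
    · simp at h1
    rcases List.eq_nil_or_concat w' with rfl | ⟨w'', a, rfl⟩
    · simp at h1; omega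
    simp only [List.concat_eq_append] at h1 h2 h3 hw
    rw [List.append_assoc, List.singleton_append, List.zip_tail_append_pair] at hw
    obtain ⟨rfl, hab⟩ := List.append_inj' hw rfl
    simp only [List.cons.injEq, Prod.mk.injEq, and_true] at hab
    obtain ⟨rfl, rfl⟩ := hab
    refine ⟨by simpa using h3.symm, ?_⟩
    cases w'' with
    | nil => left; simpa using h2.symm
    | cons c w =>
      right
      exact ⟨w.length + 1, by omega, c :: w ++ [a], by simp, by simpa using h2,
        List.getLast?_concat, hl₁⟩

theorem reaches_zip_tail {V : Type*} {l : List V} {i j : V} (h : [i, j].Sublist l) :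
    Reaches (l.zip l.tail) i j := by
  obtain ⟨s, t, rfl, hi, hj⟩ := List.cons_sublist_iff.1 h
  obtain ⟨s₁, s₂, rfl⟩ := List.append_of_mem hi
  obtain ⟨t₁, t₂, rfl⟩ := List.append_of_mem (List.singleton_sublist.1 hj)
  refine Reaches.mono (L := (i :: (s₂ ++ t₁) ++ [j]).zip (i :: (s₂ ++ t₁) ++ [j]).tail) ?_ ?_
  · exact ⟨(s₂ ++ t₁).length + 1, by omega, i :: (s₂ ++ t₁) ++ [j], by simp [add_assoc], by simp,
      by rw [List.getLast?_concat], List.Sublist.refl _⟩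
  · have := (List.zip_tail_sublist_append_right (i :: (s₂ ++ t₁) ++ [j]) t₂).trans
      (List.zip_tail_sublist_append_left s₁ _)
    simpa using this

/-- A schedule of length `m` yields a labelling of the nodes constant along served pairs, together
with a set `F` of nodes off which served pairs are increasing for a potential, such that `m` is at
least `|F|` plus the number of nodes minus the number of labels. -/
theorem exists_labelling {V : Type*} [Fintype V] [DecidableEq V] (L : List (V × V)) :
    ∃ (lab : V → V) (F : Finset V) (pos : V → ℕ),
      F.card + Fintype.card V ≤ L.length + (Finset.univ.image lab).card ∧
      ∀ x y, Reaches L x y → lab x = lab y ∧ (x ∉ F → y ∉ F → pos x < pos y) := by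
  induction L using List.reverseRecOn with
  | nil =>
    refine ⟨id, ∅, fun _ => 0, by simp, ?_⟩
    rintro x y ⟨ℓ, hℓ, w, h1, -, -, h4⟩
    have := congrArg List.length (List.sublist_nil.1 h4)
    simp at this
    omega
  | append_singleton L e ih =>
    obtain ⟨u, v⟩ := e
    obtain ⟨lab, F, pos, hcard, h⟩ := ih
    have hu : ∀ x, (x = u ∨ Reaches L x u) → lab x = lab u := by
      rintro x (rfl | hx)
      · rfl
      · exact (h _ _ hx).1
    by_cases huv : lab u = lab v
    · refine ⟨lab, insert v F, pos, ?_, ?_⟩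
      · have := Finset.card_insert_le v F
        simp only [List.length_append, List.length_singleton]
        omega
      · intro x y hxy
        rcases hxy.of_concat with hxy | ⟨rfl, hx⟩
        · refine ⟨(h _ _ hxy).1, fun hx hy => (h _ _ hxy).2 ?_ ?_⟩
          · exact fun hx' => hx (Finset.mem_insert_of_mem hx')
          · exact fun hy' => hy (Finset.mem_insert_of_mem hy')
        · exact ⟨(hu x hx).trans huv, fun _ hy => absurd (Finset.mem_insert_self _ _) hy⟩
    · refine ⟨fun x => if lab x = lab v then lab u else lab x, F,
        fun x => if lab x = lab v then pos x + (Finset.univ.sup pos + 1) else pos x, ?_, ?_⟩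
      · have hsub : (Finset.univ.image lab).erase (lab v) ⊆
            Finset.univ.image fun x => if lab x = lab v then lab u else lab x := by
          intro a ha
          obtain ⟨hne, ha⟩ := Finset.mem_erase.1 ha
          obtain ⟨x, -, rfl⟩ := Finset.mem_image.1 ha
          exact Finset.mem_image.2 ⟨x, Finset.mem_univ _, if_neg hne⟩
        have h1 := Finset.card_le_card hsub
        have h2 := Finset.pred_card_le_card_erase (s := Finset.univ.image lab) (a := lab v)
        simp only [List.length_append, List.length_singleton]
        omega
      · intro x y hxy
        rcases hxy.of_concat with hxy | ⟨rfl, hx⟩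
        · obtain ⟨hlab, hpos⟩ := h _ _ hxy
          simp only [hlab, true_and]
          intro hx hy
          have := hpos hx hy
          split_ifs <;> omega
        · have hxu := hu x hx
          have := Finset.le_sup (f := pos) (Finset.mem_univ x)
          simp only [hxu, if_neg huv, if_true, true_and]
          intros
          omega

theorem exists_schedule_of_nonempty {V : Type*} [DecidableEq V] (K F : Finset V) (pos : V → ℕ)
    (hK : K.Nonempty) :
    ∃ S : List (V × V), S.length + 1 ≤ K.card + (K ∩ F).card ∧
      ∀ i ∈ K, ∀ j ∈ K, i ≠ j → (i ∉ F → j ∉ F → pos i < pos j) → Reaches S i j := by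
  classical
  set a := (K ∩ F).toList with ha
  set b := (K \ F).toList.insertionSort (fun x y => pos x ≤ pos y) with hb
  have hbp : b.Pairwise (fun x y => pos x ≤ pos y) := by
    have : Std.Total (fun x y : V => pos x ≤ pos y) := ⟨fun x y => le_total _ _⟩
    have : IsTrans V (fun x y : V => pos x ≤ pos y) := ⟨fun x y z => le_trans⟩
    exact List.pairwise_insertionSort _ _
  have hma : ∀ x ∈ K, x ∈ F → x ∈ a := fun x h1 h2 => by simp [ha, h1, h2]
  have hmb : ∀ x ∈ K, x ∉ F → x ∈ b := fun x h1 h2 => by simp [hb, h1, h2]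
  have hlen : a.length + b.length = K.card := by
    simp [ha, hb, List.length_insertionSort, Finset.card_inter_add_card_sdiff]
  have hla : a.length = (K ∩ F).card := by simp [ha]
  have hpos := hK.card_pos
  refine ⟨(a ++ b ++ a).zip (a ++ b ++ a).tail, ?_, fun i hi j hj hij h => reaches_zip_tail ?_⟩
  · simp only [List.length_zip, List.length_tail, List.length_append]
    omega
  · have key : ∀ {l₁ l₂ : List V}, i ∈ l₁ → j ∈ l₂ → [i, j].Sublist (l₁ ++ l₂) :=
      fun h1 h2 => (List.singleton_sublist.2 h1).append (List.singleton_sublist.2 h2)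
    by_cases hjF : j ∈ F
    · refine key ?_ (hma j hj hjF)
      by_cases hiF : i ∈ F
      · exact List.mem_append_left _ (hma i hi hiF)
      · exact List.mem_append_right _ (hmb i hi hiF)
    · refine List.Sublist.trans ?_ (List.sublist_append_left _ _)
      by_cases hiF : i ∈ F
      · exact key (hma i hi hiF) (hmb j hj hjF)
      · refine List.Sublist.trans ?_ (List.sublist_append_right _ _)
        have hlt := h hiF hjF
        have hjb := hmb j hj hjF
        obtain ⟨s, t, hst⟩ := List.append_of_mem (hmb i hi hiF)
        rw [hst] at hbp hjb ⊢
        rcases List.mem_append.1 hjb with hjs | hjt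
        · have := (List.pairwise_append.1 hbp).2.2 j hjs i (by simp)
          omega
        · have hjt : j ∈ t := (List.mem_cons.1 hjt).resolve_left hij.symm
          exact ((List.singleton_sublist.2 hjt).cons_cons i).trans (List.sublist_append_right _ _)

theorem exists_schedule {V : Type*} [DecidableEq V] (A F : Finset V) (lab : V → V) (pos : V → ℕ) :
    ∃ S : List (V × V), S.length + (A.image lab).card ≤ A.card + (A ∩ F).card ∧
      ∀ i ∈ A, ∀ j ∈ A, i ≠ j → lab i = lab j → (i ∉ F → j ∉ F → pos i < pos j) →
        Reaches S i j := by
  suffices h : ∀ C ⊆ A.image lab, ∃ S : List (V × V),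
      S.length + C.card ≤
        ∑ c ∈ C, ((A.filter (lab · = c)).card + ((A ∩ F).filter (lab · = c)).card) ∧
      ∀ i ∈ A, ∀ j ∈ A, i ≠ j → lab i ∈ C → lab i = lab j →
        (i ∉ F → j ∉ F → pos i < pos j) → Reaches S i j by
    obtain ⟨S, hS, h⟩ := h _ (Finset.Subset.refl _)
    refine ⟨S, ?_, fun i hi j hj hij => h i hi j hj hij (Finset.mem_image_of_mem _ hi)⟩
    rwa [Finset.sum_add_distrib,
      ← Finset.card_eq_sum_card_fiberwise fun x hx => Finset.mem_image_of_mem lab hx,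
      ← Finset.card_eq_sum_card_fiberwise fun x hx =>
        Finset.mem_image_of_mem lab (Finset.mem_inter.1 hx).1] at hS
  intro C
  induction C using Finset.induction_on with
  | empty => exact fun _ => ⟨[], by simp, by simp⟩
  | insert c C hc ih =>
    intro hC
    obtain ⟨S, hS, h⟩ := ih ((Finset.subset_insert _ _).trans hC)
    obtain ⟨x, hx, rfl⟩ := Finset.mem_image.1 (hC (Finset.mem_insert_self _ _))
    obtain ⟨T, hT, h'⟩ := exists_schedule_of_nonempty (A.filter (lab · = lab x)) F pos
      ⟨x, by simp [hx]⟩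
    refine ⟨S ++ T, ?_, fun i hi j hj hij hiC hlab hpos => ?_⟩
    · rw [Finset.sum_insert hc, Finset.card_insert_of_notMem hc, List.length_append]
      rw [Finset.filter_inter] at hT
      omega
    · rcases Finset.mem_insert.1 hiC with hi' | hi'
      · exact (h' i (by simp [hi, hi']) j (by simp [hj, ← hlab, hi']) hij hpos).mono
          (List.sublist_append_right _ _)
      · exact (h i hi j hj hij hi' hlab hpos).mono (List.sublist_append_left _ _)

theorem exists_isMultihopSolution {V : Type*} (E : Finset (V × V)) :
    ∃ L : List (V × V), IsMultihopSolution L E := by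
  refine ⟨E.toList, fun p hp => ⟨1, le_rfl, [p.1, p.2], by simp, by simp, by simp, ?_⟩⟩
  simpa using hp

/-- A solution of the union of two node-disjoint demand sets can be replaced by separate solutions
of the two parts, of no larger total length. -/
theorem exists_separate_solutions {V : Type*} [Fintype V] [DecidableEq V]
    {E₁ E₂ : Finset (V × V)}
    (h₁ : ∀ p ∈ E₁, p.1 ≠ p.2) (h₂ : ∀ p ∈ E₂, p.1 ≠ p.2)
    (hdisj : ∀ v : V, Touches E₁ v → ¬ Touches E₂ v)
    {L : List (V × V)} (hL : IsMultihopSolution L (E₁ ∪ E₂)) :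
    ∃ L₁ L₂ : List (V × V), IsMultihopSolution L₁ E₁ ∧ IsMultihopSolution L₂ E₂ ∧
      L₁.length + L₂.length ≤ L.length := by
  classical
  obtain ⟨lab, F, pos, hcard, h⟩ := exists_labelling L
  set A : Finset V := Finset.univ.filter (Touches E₁) with hA
  obtain ⟨S, hS, hS'⟩ := exists_schedule A F lab pos
  obtain ⟨T, hT, hT'⟩ := exists_schedule Aᶜ F lab pos
  refine ⟨S, T, fun p hp => ?_, fun p hp => ?_, ?_⟩
  · obtain ⟨hl, hp'⟩ := h _ _ (hL p (Finset.mem_union_left _ hp))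
    refine hS' _ ?_ _ ?_ (h₁ p hp) hl hp'
    · simpa [hA] using ⟨p, hp, Or.inl rfl⟩
    · simpa [hA] using ⟨p, hp, Or.inr rfl⟩
  · obtain ⟨hl, hp'⟩ := h _ _ (hL p (Finset.mem_union_right _ hp))
    refine hT' _ ?_ _ ?_ (h₂ p hp) hl hp'
    · simpa [hA] using fun ht => hdisj _ ht ⟨p, hp, Or.inl rfl⟩
    · simpa [hA] using fun ht => hdisj _ ht ⟨p, hp, Or.inr rfl⟩
  · have hi : (Finset.univ.image lab).card ≤ (A.image lab).card + (Aᶜ.image lab).card := by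
      rw [← Finset.union_compl A, Finset.image_union]
      exact Finset.card_union_le _ _
    have hF : (A ∩ F).card + (Aᶜ ∩ F).card = F.card := by
      rw [← Finset.card_union_of_disjoint, ← Finset.union_inter_distrib_right,
        Finset.union_compl, Finset.univ_inter]
      exact disjoint_compl_right.mono Finset.inter_subset_left Finset.inter_subset_left
    have hV := Finset.card_add_card_compl A
    omega

/-- If no node is incident both to a demand of `E₁` and to a demand of `E₂`, then the
minimum length of a multihop solution for `E₁ ∪ E₂` equals the sum of the minimum
lengths of multihop solutions for `E₁` and for `E₂`. -/
theorem multihop_disjoint_components {V : Type*} [Fintype V] [DecidableEq V]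
    (E₁ E₂ : Finset (V × V))
    (h₁ : ∀ p ∈ E₁, p.1 ≠ p.2) (h₂ : ∀ p ∈ E₂, p.1 ≠ p.2)
    (hdisj : ∀ v : V, Touches E₁ v → ¬ Touches E₂ v) :
    sInf {m | ∃ L : List (V × V), IsMultihopSolution L (E₁ ∪ E₂) ∧ L.length = m} =
      sInf {m | ∃ L : List (V × V), IsMultihopSolution L E₁ ∧ L.length = m} +
        sInf {m | ∃ L : List (V × V), IsMultihopSolution L E₂ ∧ L.length = m} := by
  refine le_antisymm ?_ ?_
  · obtain ⟨L₁, hL₁, hl₁⟩ := Nat.sInf_mem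
      (s := {m | ∃ L : List (V × V), IsMultihopSolution L E₁ ∧ L.length = m})
      ((exists_isMultihopSolution E₁).imp' List.length fun L hL => ⟨L, hL, rfl⟩)
    obtain ⟨L₂, hL₂, hl₂⟩ := Nat.sInf_mem
      (s := {m | ∃ L : List (V × V), IsMultihopSolution L E₂ ∧ L.length = m})
      ((exists_isMultihopSolution E₂).imp' List.length fun L hL => ⟨L, hL, rfl⟩)
    rw [← hl₁, ← hl₂, ← List.length_append]
    refine Nat.sInf_le ⟨L₁ ++ L₂, fun p hp => ?_, rfl⟩
    rcases Finset.mem_union.1 hp with hp | hp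
    · exact Reaches.mono (hL₁ p hp) (List.sublist_append_left _ _)
    · exact Reaches.mono (hL₂ p hp) (List.sublist_append_right _ _)
  · obtain ⟨L, hL, hl⟩ := Nat.sInf_mem
      (s := {m | ∃ L : List (V × V), IsMultihopSolution L (E₁ ∪ E₂) ∧ L.length = m})
      ((exists_isMultihopSolution (E₁ ∪ E₂)).imp' List.length fun L hL => ⟨L, hL, rfl⟩)
    rw [← hl]
    obtain ⟨L₁, L₂, hL₁, hL₂, hle⟩ := exists_separate_solutions h₁ h₂ hdisj hL
    refine le_trans (Nat.add_le_add ?_ ?_) hle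
    · exact Nat.sInf_le ⟨L₁, hL₁, rfl⟩
    · exact Nat.sInf_le ⟨L₂, hL₂, rfl⟩
end
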